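/- arXiv:math/0209087 — 2 statements merged into one kernel-verified Lean document; each statement's English description precedes it below -/
import Mathlib

section
/- For every real c ≥ 2.468155 and every sequence (m_n) of natural numbers with m_n/n → c as n → ∞ and m_n ≤ n(n−1)/2, the proportion of simple graphs on the vertex set Fin n having exactly m_n edges that are 3-colourable tends to 0 as n → ∞. -/
open Filter

theorem Matrix.PosSemidef.dot_nonneg {ι : Type*} [Fintype ι] {M : Matrix ι ι ℝ} (hM : M.PosSemidef)
    (x : ι → ℝ) : 0 ≤ ∑ i, ∑ j, x i * x j * M i j := by
  have := hM.dotProduct_mulVec_nonneg x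
  simp only [dotProduct, Matrix.mulVec, star_trivial, Finset.mul_sum] at this
  refine this.trans_eq (Finset.sum_congr rfl fun i _ => Finset.sum_congr rfl fun j _ => by ring)

/-- The Newton-type iteration with limit `1 - √(1 - x)`. -/
noncomputable def sqrtIter (x : ℝ) : ℕ → ℝ
  | 0 => 0
  | k + 1 => (x + sqrtIter x k ^ 2) / 2

theorem sqrtIter_bounds {x : ℝ} (h0 : 0 ≤ x) (h1 : x ≤ 1) (k : ℕ) :
    0 ≤ sqrtIter x k ∧ sqrtIter x k ≤ 1 ∧ sqrtIter x k ≤ sqrtIter x (k + 1) := by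
  induction k with
  | zero => simp [sqrtIter]; linarith
  | succ k ih =>
    obtain ⟨a, b, c⟩ := ih
    have h : sqrtIter x (k + 1) = (x + sqrtIter x k ^ 2) / 2 := rfl
    have h' : sqrtIter x (k + 2) = (x + sqrtIter x (k + 1) ^ 2) / 2 := rfl
    refine ⟨by rw [h]; positivity, by rw [h]; nlinarith, ?_⟩
    rw [h']
    nlinarith

theorem tendsto_sqrtIter {x : ℝ} (h0 : 0 ≤ x) (h1 : x ≤ 1) :
    Tendsto (sqrtIter x) atTop (nhds (1 - √(1 - x))) := by
  have hb := sqrtIter_bounds h0 h1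
  have hmono : Monotone (sqrtIter x) := monotone_nat_of_le_succ fun k => (hb k).2.2
  have hbdd : BddAbove (Set.range (sqrtIter x)) := ⟨1, by rintro _ ⟨k, rfl⟩; exact (hb k).2.1⟩
  obtain ⟨l, hl⟩ : ∃ l, Tendsto (sqrtIter x) atTop (nhds l) := ⟨_, tendsto_atTop_ciSup hmono hbdd⟩
  have hl1 : l ≤ 1 := le_of_tendsto' hl fun k => (hb k).2.1
  have hfix : l = (x + l ^ 2) / 2 :=
    tendsto_nhds_unique (hl.comp (tendsto_add_atTop_nat 1)) (((hl.pow 2).const_add x).div_const 2)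
  have : √(1 - x) = 1 - l := by
    rw [show 1 - x = (1 - l) ^ 2 by linarith]
    exact Real.sqrt_sq (by linarith)
  rwa [this, sub_sub_cancel]

theorem Matrix.PosSemidef.one_sub_sqrt {ι : Type*} [Fintype ι] {M : Matrix ι ι ℝ}
    (hM : M.PosSemidef) (h0 : ∀ i j, 0 ≤ M i j) (h1 : ∀ i j, M i j ≤ 1) :
    (M.map fun x => 1 - √(1 - x)).PosSemidef := by
  have hk : ∀ k, (M.map fun x => sqrtIter x k).PosSemidef := by
    intro k
    induction k with
    | zero =>
      convert Matrix.PosSemidef.zero (n := ι) (R := ℝ)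
      ext; simp [sqrtIter]
    | succ k ih =>
      have := (hM.add (ih.hadamard ih)).smul (show (0 : ℝ) ≤ 1 / 2 by norm_num)
      convert this using 1
      ext i j
      simp [sqrtIter]; ring
  refine Matrix.PosSemidef.of_dotProduct_mulVec_nonneg ?_ fun x => ?_
  · ext i j
    have := congrFun (congrFun hM.isHermitian i) j
    simp only [Matrix.conjTranspose_apply, star_trivial] at this
    simp [this]
  · refine ge_of_tendsto' (x := atTop)
      (f := fun k => star x ⬝ᵥ (M.map fun y => sqrtIter y k).mulVec x) ?_
      fun k => (hk k).dotProduct_mulVec_nonneg x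
    simp only [dotProduct, Matrix.mulVec, Matrix.map_apply]
    exact tendsto_finsetSum _ fun i _ => Tendsto.const_mul _ <| tendsto_finsetSum _ fun j _ =>
      Tendsto.mul_const _ (tendsto_sqrtIter (h0 i j) (h1 i j))

section
open scoped Classical

variable {V : Type*}

/-- The number of nonempty members of a multiset of sets of colourings. -/
noncomputable def alive (L : Multiset (Set (V → Fin 3))) : ℝ :=
  (L.map fun S => if S.Nonempty then (1 : ℝ) else 0).sum

/-- Impose the edge `p` on every member. -/
def edgeStep (L : Multiset (Set (V → Fin 3))) (p : V × V) : Multiset (Set (V → Fin 3)) :=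
  L.map fun S => S ∩ {σ | σ p.1 ≠ σ p.2}

/-- Replace every member by four copies: an unchanged one, and one for each colour, which is then
forbidden at `v`. -/
def fieldStep (L : Multiset (Set (V → Fin 3))) (v : V) : Multiset (Set (V → Fin 3)) :=
  L + ∑ i : Fin 3, L.map fun S => S ∩ {σ | σ v ≠ i}

theorem alive_add (L L' : Multiset (Set (V → Fin 3))) : alive (L + L') = alive L + alive L' := by
  simp [alive]

theorem alive_sum {ι : Type*} (s : Finset ι) (L : ι → Multiset (Set (V → Fin 3))) :
    alive (∑ i ∈ s, L i) = ∑ i ∈ s, alive (L i) := by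
  induction s using Finset.induction_on with
  | empty => simp [alive]
  | insert a s ha ih => rw [Finset.sum_insert ha, Finset.sum_insert ha, alive_add, ih]

theorem alive_nonneg (L : Multiset (Set (V → Fin 3))) : 0 ≤ alive L := by
  refine Multiset.sum_nonneg fun x hx => ?_
  obtain ⟨S, -, rfl⟩ := Multiset.mem_map.1 hx
  split_ifs <;> norm_num

theorem fieldStep_add (L L' : Multiset (Set (V → Fin 3))) (v : V) :
    fieldStep (L + L') v = fieldStep L v + fieldStep L' v := by
  simp only [fieldStep, Multiset.map_add, Finset.sum_add_distrib]
  abel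

theorem edgeStep_fieldStep (L : Multiset (Set (V → Fin 3))) (p : V × V) (v : V) :
    edgeStep (fieldStep L v) p = fieldStep (edgeStep L p) v := by
  simp only [edgeStep, fieldStep, Multiset.map_add, Multiset.map_map, Fin.sum_univ_three,
    Function.comp_def, Set.inter_right_comm]

/-- The indicator of `S` being nonempty with all its members taking the value `i` at a vertex; the
extra coordinate `none` stands for an independent message, equal to `i` with probability `1/4`. -/
noncomputable def frozenVec (S : Set (V → Fin 3)) (i : Fin 3) : Option V → ℝ
  | none => if S.Nonempty then 1 / 4 else 0
  | some v => if S.Nonempty ∧ ∀ σ ∈ S, σ v = i then 1 else 0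

/-- The sum of the Gram matrices of the vectors `frozenVec S i` over the members `S`. -/
noncomputable def gram (L : Multiset (Set (V → Fin 3))) : Matrix (Option V) (Option V) ℝ :=
  (L.map fun S => ∑ i, Matrix.vecMulVec (frozenVec S i) (frozenVec S i)).sum

theorem gram_cons (S : Set (V → Fin 3)) (L : Multiset (Set (V → Fin 3))) (x y : Option V) :
    gram (S ::ₘ L) x y = ∑ i, frozenVec S i x * frozenVec S i y + gram L x y := by
  simp [gram, Matrix.vecMulVec_apply, Matrix.sum_apply]

theorem alive_cons (S : Set (V → Fin 3)) (L : Multiset (Set (V → Fin 3))) :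
    alive (S ::ₘ L) = (if S.Nonempty then 1 else 0) + alive L := by
  simp [alive]

theorem frozenVec_nonneg (S : Set (V → Fin 3)) (i : Fin 3) (x : Option V) :
    0 ≤ frozenVec S i x := by
  cases x <;> (simp only [frozenVec]; positivity)

theorem gram_nonneg (L : Multiset (Set (V → Fin 3))) (x y : Option V) : 0 ≤ gram L x y := by
  induction L using Multiset.induction_on with
  | empty => simp [gram]
  | cons S L ih =>
    rw [gram_cons]
    exact add_nonneg (Finset.sum_nonneg fun i _ =>
      mul_nonneg (frozenVec_nonneg ..) (frozenVec_nonneg ..)) ih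

theorem gram_none_none (L : Multiset (Set (V → Fin 3))) :
    gram L none none = 3 / 16 * alive L := by
  induction L using Multiset.induction_on with
  | empty => simp [gram, alive]
  | cons S L ih =>
    rw [gram_cons, alive_cons, ih]
    simp only [frozenVec]
    split_ifs
    · simp; ring
    · simp

theorem gram_comm (L : Multiset (Set (V → Fin 3))) (x y : Option V) :
    gram L x y = gram L y x := by
  induction L using Multiset.induction_on with
  | empty => simp [gram]
  | cons S L ih => rw [gram_cons, gram_cons, ih]; simp only [mul_comm]

theorem posSemidef_gram [Fintype V] (L : Multiset (Set (V → Fin 3))) : (gram L).PosSemidef := by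
  induction L using Multiset.induction_on with
  | empty => simpa [gram] using Matrix.PosSemidef.zero
  | cons S L ih =>
    have : gram (S ::ₘ L) = ∑ i, Matrix.vecMulVec (frozenVec S i) (frozenVec S i) + gram L := by
      simp [gram]
    rw [this]
    refine Matrix.PosSemidef.add (Matrix.posSemidef_sum _ fun i _ => ?_) ih
    simpa using Matrix.posSemidef_vecMulVec_self_star (frozenVec S i)

theorem alive_fieldStep (L : Multiset (Set (V → Fin 3))) (v : V) :
    alive (fieldStep L v) = 4 * (alive L - gram L (some v) none) := by
  induction L using Multiset.induction_on with
  | empty => simp [gram, alive, fieldStep]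
  | cons S L ih =>
    have key : alive (fieldStep {S} v) =
        4 * ((if S.Nonempty then 1 else 0) - ∑ i, frozenVec S i (some v) * frozenVec S i none) := by
      have h : ∀ i : Fin 3, (if (S ∩ {σ | σ v ≠ i}).Nonempty then (1 : ℝ) else 0) =
          (if S.Nonempty then 1 else 0) - 4 * (frozenVec S i (some v) * frozenVec S i none) := by
        intro i
        simp only [frozenVec]
        have : (S ∩ {σ | σ v ≠ i}).Nonempty ↔ ¬ ∀ σ ∈ S, σ v = i := by
          simp [Set.Nonempty]
        by_cases hS : S.Nonempty
        · by_cases h2 : ∀ σ ∈ S, σ v = i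
          · rw [if_neg (by rw [this]; exact not_not.2 h2), if_pos hS, if_pos ⟨hS, h2⟩, if_pos hS]
            norm_num
          · rw [if_pos (this.2 h2), if_pos hS, if_neg fun h => h2 h.2]
            norm_num
        · simp [Set.not_nonempty_iff_eq_empty.1 hS]
      rw [fieldStep, alive_add, alive_sum]
      simp only [alive, Multiset.map_singleton, Multiset.sum_singleton, h]
      rw [Finset.sum_sub_distrib, ← Finset.mul_sum]
      simp only [Finset.sum_const, Finset.card_univ, Fintype.card_fin, nsmul_eq_mul]
      push_cast
      ring
    rw [← Multiset.singleton_add, fieldStep_add, alive_add, ih, key, Multiset.singleton_add,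
      gram_cons, alive_cons]
    ring

theorem alive_edgeStep_le (L : Multiset (Set (V → Fin 3))) (u v : V) :
    alive (edgeStep L (u, v)) ≤ alive L - gram L (some u) (some v) := by
  induction L using Multiset.induction_on with
  | empty => simp [gram, alive, edgeStep]
  | cons S L ih =>
    have key : (if (S ∩ {σ | σ u ≠ σ v}).Nonempty then (1 : ℝ) else 0) ≤
        (if S.Nonempty then 1 else 0) - ∑ i, frozenVec S i (some u) * frozenVec S i (some v) := by
      by_cases hS : S.Nonempty
      swap
      · simp [Set.not_nonempty_iff_eq_empty.1 hS, frozenVec]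
      obtain ⟨σ, hσ⟩ := hS
      have hle : ∀ i, frozenVec S i (some u) * frozenVec S i (some v) ≤
          if i = σ u then (if (S ∩ {σ | σ u ≠ σ v}).Nonempty then (0 : ℝ) else 1) else 0 := by
        intro i
        simp only [frozenVec]
        split_ifs with h1 h2 h3 h4 h5 h6 h7 h8 <;> try norm_num
        · obtain ⟨τ, hτ, hne⟩ := h4
          exact hne ((h1.2 τ hτ).trans (h2.2 τ hτ).symm)
        · exact h3 (h1.2 σ hσ).symm
      have hsum := Finset.sum_le_sum fun i (_ : i ∈ Finset.univ) => hle i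
      rw [Finset.sum_ite_eq' Finset.univ (σ u)] at hsum
      simp only [Finset.mem_univ, if_true] at hsum
      rw [if_pos (show S.Nonempty from ⟨σ, hσ⟩)]
      split_ifs at hsum ⊢ <;> linarith
    have e : edgeStep (S ::ₘ L) (u, v) = (S ∩ {σ | σ u ≠ σ v}) ::ₘ edgeStep L (u, v) := by
      simp [edgeStep]
    rw [e, alive_cons, alive_cons, gram_cons]
    linarith

/-- Trading one random edge for one random message: the entrywise function `1 - √√(1 - x)` keeps
the normalised Gram matrix positive semidefinite. -/
theorem interpolation_step [Fintype V] (L : Multiset (Set (V → Fin 3))) :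
    ∑ p : V × V, √√(alive (edgeStep L p)) + √√(13 / 16) * (Fintype.card V : ℝ) ^ 2 * √√(alive L) ≤
      √2 * Fintype.card V * ∑ v, √√(alive (fieldStep L v)) := by
  set W := alive L with hW
  have hW0 : 0 ≤ W := alive_nonneg L
  have hX : ∀ u v, gram L (some u) (some v) ≤ W := fun u v => by
    have := alive_edgeStep_le L u v
    have := alive_nonneg (edgeStep L (u, v))
    linarith
  have hY : ∀ v, gram L (some v) none ≤ W := fun v => by
    have := alive_fieldStep L v
    have := alive_nonneg (fieldStep L v)
    linarith
  have hZ := gram_none_none L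
  rcases hW0.eq_or_lt with h0 | hpos
  · have h1 : ∀ p : V × V, √√(alive (edgeStep L p)) = 0 := by
      rintro ⟨u, v⟩
      have := alive_edgeStep_le L u v
      have := gram_nonneg L (some u) (some v)
      rw [show √(alive (edgeStep L (u, v))) = 0 from Real.sqrt_eq_zero_of_nonpos (by linarith),
        Real.sqrt_zero]
    simp only [h1, ← h0]
    simp
    positivity
  set M : Matrix (Option V) (Option V) ℝ := W⁻¹ • gram L with hM
  have hMp : M.PosSemidef := (posSemidef_gram L).smul (by positivity)
  have hMe : ∀ x y, M x y = gram L x y / W := fun x y => by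
    simp [hM, Matrix.smul_apply]; ring
  have hM0 : ∀ x y, 0 ≤ M x y := fun x y => by
    rw [hMe]; exact div_nonneg (gram_nonneg ..) hW0
  have hM1 : ∀ x y, M x y ≤ 1 := fun x y => by
    rw [hMe, div_le_one hpos]
    rcases x with _ | u <;> rcases y with _ | v
    · rw [hZ]; linarith
    · rw [gram_comm]; exact hY v
    · exact hY u
    · exact hX u v
  have h1 := hMp.one_sub_sqrt hM0 hM1
  have h2 := h1.one_sub_sqrt
    (fun x y => by simpa using hM0 x y)
    (fun x y => by simp)
  have hq := h2.dot_nonneg fun x => x.elim (-(Fintype.card V : ℝ)) fun _ => 1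
  simp only [Matrix.map_apply, sub_sub_cancel, Fintype.sum_option, Option.elim_none,
    Option.elim_some, one_mul, mul_one] at hq
  have hsymm : ∀ v, M none (some v) = M (some v) none := fun v => by
    rw [hMe, hMe, gram_comm]
  have hz : M none none = 3 / 16 := by rw [hMe, hZ, ← hW]; field_simp
  simp only [hsymm, hz, Finset.sum_add_distrib, ← Finset.mul_sum, Finset.sum_sub_distrib,
    Finset.sum_const, Finset.card_univ, nsmul_eq_mul, mul_one] at hq
  have hsc : ∀ t : ℝ, √√(1 - t / W) * √√W = √√(W - t) := fun t => by
    rw [← Real.sqrt_mul (Real.sqrt_nonneg _), ← Real.sqrt_mul' _ hW0]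
    congr 3
    field_simp
  have hE : ∑ p : V × V, √√(alive (edgeStep L p)) ≤
      (∑ u, ∑ v, √√(1 - M (some u) (some v))) * √√W := by
    rw [Fintype.sum_prod_type, Finset.sum_mul]
    refine Finset.sum_le_sum fun u _ => ?_
    rw [Finset.sum_mul]
    refine Finset.sum_le_sum fun v _ => ?_
    rw [hMe, hsc]
    exact Real.sqrt_le_sqrt (Real.sqrt_le_sqrt (alive_edgeStep_le L u v))
  have hF : √2 * ((∑ v, √√(1 - M (some v) none)) * √√W) = ∑ v, √√(alive (fieldStep L v)) := by
    rw [Finset.sum_mul, Finset.mul_sum]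
    refine Finset.sum_congr rfl fun v _ => ?_
    rw [hMe, hsc, alive_fieldStep, Real.sqrt_mul (by norm_num), Real.sqrt_mul (by positivity),
      show (4 : ℝ) = 2 ^ 2 by norm_num, Real.sqrt_sq (by norm_num)]
  rw [← hF]
  have h22 : √2 * √2 = (2 : ℝ) := Real.mul_self_sqrt (by norm_num)
  have hR : √2 * (Fintype.card V : ℝ) * (√2 * ((∑ v, √√(1 - M (some v) none)) * √√W)) =
      2 * Fintype.card V * (∑ v, √√(1 - M (some v) none)) * √√W := by
    linear_combination (Fintype.card V : ℝ) * ((∑ v, √√(1 - M (some v) none)) * √√W) * h22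
  rw [hR]
  have h13 : (1 : ℝ) - 3 / 16 = 13 / 16 := by norm_num
  rw [h13] at hq
  have hWs : 0 ≤ √√W := Real.sqrt_nonneg _
  nlinarith [mul_nonneg hq hWs]

/-- Sum over all ways of imposing one edge. -/
def edgeOp [Fintype V] : Module.End ℝ (Multiset (Set (V → Fin 3)) → ℝ) where
  toFun ψ L := ∑ p : V × V, ψ (edgeStep L p)
  map_add' _ _ := funext fun _ => Finset.sum_add_distrib
  map_smul' _ _ := funext fun _ => (Finset.mul_sum ..).symm

/-- Sum over all positions of one random message. -/
def fieldOp [Fintype V] : Module.End ℝ (Multiset (Set (V → Fin 3)) → ℝ) where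
  toFun ψ L := ∑ v, ψ (fieldStep L v)
  map_add' _ _ := funext fun _ => Finset.sum_add_distrib
  map_smul' _ _ := funext fun _ => (Finset.mul_sum ..).symm

/-- The fourth root of the number of nonempty members. -/
noncomputable def rootAlive (L : Multiset (Set (V → Fin 3))) : ℝ := √√(alive L)

theorem rootAlive_singleton (S : Set (V → Fin 3)) :
    rootAlive {S} = if S.Nonempty then 1 else 0 := by
  simp only [rootAlive, alive, Multiset.map_singleton, Multiset.sum_singleton]
  split_ifs <;> simp

/-- The number of sequences of `d` messages in `Option (Fin 3)` which do not block all of a given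
set of `b` colours. -/
def messageCount : ℕ → ℕ → ℕ
  | b, 0 => if b = 0 then 0 else 1
  | b, d + 1 => (4 - b) * messageCount b d + b * messageCount (b - 1) d

theorem foldl_fieldStep_add (w : List V) (L L' : Multiset (Set (V → Fin 3))) :
    w.foldl fieldStep (L + L') = w.foldl fieldStep L + w.foldl fieldStep L' := by
  induction w generalizing L L' with
  | nil => rfl
  | cons v w ih => simp only [List.foldl_cons, fieldStep_add, ih]

theorem fieldStep_pi (B : V → Finset (Fin 3)) (v : V) :
    fieldStep {{σ : V → Fin 3 | ∀ u, σ u ∈ B u}} v =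
      {{σ | ∀ u, σ u ∈ B u}} +
        ∑ i, {{σ | ∀ u, σ u ∈ Function.update B v ((B v).erase i) u}} := by
  simp only [fieldStep, Multiset.map_singleton]
  congr 1
  refine Finset.sum_congr rfl fun i _ => ?_
  congr 1
  ext σ
  simp only [Set.mem_inter_iff, Set.mem_ofPred_eq]
  constructor
  · rintro ⟨h1, h2⟩ u
    by_cases hu : u = v
    · subst hu; simp [h1 u, h2]
    · simp [hu, h1 u]
  · intro h
    refine ⟨fun u => ?_, ?_⟩
    · by_cases hu : u = v
      · subst hu; have := h u; simp at this; exact this.2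
      · have := h u; simpa [hu] using this
    · have := h v; simp at this; exact this.1

variable [Fintype V]

theorem edgeOp_apply (ψ : Multiset (Set (V → Fin 3)) → ℝ) (L : Multiset (Set (V → Fin 3))) :
    edgeOp ψ L = ∑ p : V × V, ψ (edgeStep L p) := rfl

theorem fieldOp_apply (ψ : Multiset (Set (V → Fin 3)) → ℝ) (L : Multiset (Set (V → Fin 3))) :
    fieldOp ψ L = ∑ v, ψ (fieldStep L v) := rfl

theorem edgeOp_mono : Monotone (edgeOp (V := V)) := fun _ _ h _ =>
  Finset.sum_le_sum fun _ _ => h _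

theorem fieldOp_mono : Monotone (fieldOp (V := V)) := fun _ _ h _ =>
  Finset.sum_le_sum fun _ _ => h _

theorem commute_edgeOp_fieldOp : Commute (edgeOp (V := V)) fieldOp := by
  refine LinearMap.ext fun ψ => funext fun L => ?_
  simp only [Module.End.mul_apply, edgeOp_apply, fieldOp_apply, edgeStep_fieldStep]
  exact Finset.sum_comm

theorem Module.End.pow_mono {α : Type*} {A : Module.End ℝ (α → ℝ)} (hA : Monotone A) (k : ℕ) :
    Monotone (A ^ k) := by
  induction k with
  | zero => intro _ _ h; simpa using h
  | succ k ih => intro _ _ h; simpa [pow_succ] using ih (hA h)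

theorem Module.End.pow_apply_le {α : Type*} {A D : Module.End ℝ (α → ℝ)} (hA : Monotone A)
    (hD : Monotone D) (hc : Commute A D) {t : ℝ} (ht : 0 ≤ t) {φ : α → ℝ} (h : A φ ≤ t • D φ)
    (j : ℕ) : (A ^ j) φ ≤ t ^ j • (D ^ j) φ := by
  induction j with
  | zero => simp
  | succ j ih =>
    calc (A ^ (j + 1)) φ = (A ^ j) (A φ) := by simp [pow_succ]
      _ ≤ (A ^ j) (t • D φ) := Module.End.pow_mono hA j h
      _ = t • D ((A ^ j) φ) := by
        rw [map_smul, ← Module.End.mul_apply, (hc.pow_left j).eq, Module.End.mul_apply]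
      _ ≤ t • D (t ^ j • (D ^ j) φ) := smul_le_smul_of_nonneg_left (hD ih) ht
      _ = t ^ (j + 1) • (D ^ (j + 1)) φ := by
        rw [map_smul, smul_smul, ← _root_.pow_succ', _root_.pow_succ' D, Module.End.mul_apply]

theorem Module.End.choose_mul_le {α : Type*} {A : Module.End ℝ (α → ℝ)} (hA : Monotone A)
    {b : ℝ} (hb : 0 ≤ b) {φ : α → ℝ} (hφ : 0 ≤ φ) (m r : ℕ) (a : α) :
    ((m + r).choose m : ℝ) * b ^ r * (A ^ m) φ a ≤
      ((A + b • (1 : Module.End ℝ (α → ℝ))) ^ (m + r)) φ a := by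
  have hc : Commute A (b • (1 : Module.End ℝ (α → ℝ))) := (Commute.one_right A).smul_right b
  have hk : ∀ k, 0 ≤ (A ^ k) φ := fun k => by
    have := Module.End.pow_mono hA k hφ
    rwa [map_zero] at this
  rw [hc.add_pow]
  have e : ∀ k, (A ^ k * (b • (1 : Module.End ℝ (α → ℝ))) ^ (m + r - k) *
      ((m + r).choose k : Module.End ℝ (α → ℝ))) φ a =
      ((m + r).choose k : ℝ) * b ^ (m + r - k) * (A ^ k) φ a := fun k => by
    rw [Module.End.mul_apply, Module.End.mul_apply, Module.End.natCast_apply, map_nsmul, map_nsmul,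
      ← Nat.cast_smul_eq_nsmul ℝ, smul_pow, one_pow, LinearMap.smul_apply, Module.End.one_apply,
      map_smul, smul_smul]
    rfl
  simp only [LinearMap.sum_apply, Finset.sum_apply, e]
  have := Finset.single_le_sum (s := Finset.range (m + r + 1))
    (f := fun k => ((m + r).choose k : ℝ) * b ^ (m + r - k) * (A ^ k) φ a)
    (fun k _ => mul_nonneg (by positivity) (hk k a)) (Finset.mem_range.2 (by omega : m < m + r + 1))
  simpa using this

/-- The interpolation inequality. -/
theorem edgeOp_pow_le (m r : ℕ) (L : Multiset (Set (V → Fin 3))) :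
    ((m + r).choose m : ℝ) * (√√(13 / 16) * (Fintype.card V : ℝ) ^ 2) ^ r *
        (edgeOp ^ m) rootAlive L ≤
      (√2 * Fintype.card V) ^ (m + r) * (fieldOp ^ (m + r)) rootAlive L := by
  set b := √√(13 / 16) * (Fintype.card V : ℝ) ^ 2
  have hb : 0 ≤ b := by positivity
  refine (Module.End.choose_mul_le edgeOp_mono hb (fun L => Real.sqrt_nonneg _) m r L).trans ?_
  refine Module.End.pow_apply_le (D := fieldOp) ?_ fieldOp_mono ?_ (by positivity) ?_ (m + r) L
  · intro ψ ψ' h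
    exact add_le_add (edgeOp_mono h) (smul_le_smul_of_nonneg_left h hb)
  · exact commute_edgeOp_fieldOp.add_left ((Commute.one_left _).smul_left b)
  · exact interpolation_step

theorem edgeOp_pow_singleton (m : ℕ) (S : Set (V → Fin 3)) :
    (edgeOp ^ m) rootAlive {S} =
      ∑ e : Fin m → V × V, if ∃ σ ∈ S, ∀ i, σ (e i).1 ≠ σ (e i).2 then (1 : ℝ) else 0 := by
  induction m generalizing S with
  | zero =>
    simp only [pow_zero, Module.End.one_apply, rootAlive_singleton, Set.Nonempty,
      IsEmpty.forall_iff,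
      and_true, Finset.sum_const, Finset.card_univ, Fintype.card_unique, one_smul]
    congr
  | succ m ih =>
    rw [pow_succ', Module.End.mul_apply, edgeOp_apply,
      ← (Fin.consEquiv fun _ => V × V).sum_comp]
    refine (Finset.sum_congr rfl fun p _ => ?_).trans (Fintype.sum_prod_type _).symm
    rw [edgeStep, Multiset.map_singleton, ih]
    refine Finset.sum_congr rfl fun e _ => ?_
    simp [Fin.forall_fin_succ, Fin.consEquiv, and_assoc]

theorem edgeOp_pow_add_le (m k : ℕ) (L : Multiset (Set (V → Fin 3))) :
    (edgeOp ^ (m + k)) rootAlive L ≤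
      (Fintype.card V : ℝ) ^ (2 * k) * (edgeOp ^ m) rootAlive L := by
  have h : edgeOp (rootAlive (V := V)) ≤ ((Fintype.card V : ℝ) ^ 2) • rootAlive := fun L => by
    rw [edgeOp_apply]
    refine (Finset.sum_le_card_nsmul _ _ (rootAlive L) fun p _ => ?_).trans_eq ?_
    · refine Real.sqrt_le_sqrt (Real.sqrt_le_sqrt ((alive_edgeStep_le L p.1 p.2).trans ?_))
      linarith [gram_nonneg L (some p.1) (some p.2)]
    · simp [sq]
  induction k with
  | zero => simp
  | succ k ih =>
    have := Module.End.pow_mono edgeOp_mono (m + k) h L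
    rw [map_smul] at this
    calc (edgeOp ^ (m + (k + 1))) rootAlive L = (edgeOp ^ (m + k)) (edgeOp rootAlive) L := by
          rw [← add_assoc, pow_succ, Module.End.mul_apply]
      _ ≤ (Fintype.card V : ℝ) ^ 2 * (edgeOp ^ (m + k)) rootAlive L := this
      _ ≤ (Fintype.card V : ℝ) ^ 2 * ((Fintype.card V : ℝ) ^ (2 * k) * (edgeOp ^ m) rootAlive L) :=
          mul_le_mul_of_nonneg_left ih (by positivity)
      _ = _ := by ring

theorem sum_messageCount_erase (B : Finset (Fin 3)) (d : ℕ) :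
    messageCount B.card d + ∑ i, messageCount (B.erase i).card d = messageCount B.card (d + 1) := by
  have hB : B.card ≤ 3 := by simpa using Finset.card_le_univ B
  have h : ∀ i, messageCount (B.erase i).card d =
      if i ∈ B then messageCount (B.card - 1) d else messageCount B.card d := fun i => by
    split_ifs with hi
    · rw [Finset.card_erase_of_mem hi]
    · rw [Finset.erase_eq_of_notMem hi]
  have hc : (Finset.univ.filter fun i => i ∉ B).card = 3 - B.card := by
    rw [Finset.filter_notMem_eq_sdiff, Finset.card_univ_sdiff, Fintype.card_fin]
  simp only [h, Finset.sum_ite, Finset.sum_const, hc, smul_eq_mul, messageCount,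
    Finset.filter_univ_mem]
  rw [show 4 - B.card = 3 - B.card + 1 by omega]
  ring

theorem alive_foldl_fieldStep (w : List V) (B : V → Finset (Fin 3)) :
    alive (w.foldl fieldStep {{σ : V → Fin 3 | ∀ u, σ u ∈ B u}}) =
      ∏ v, (messageCount (B v).card (w.count v) : ℝ) := by
  induction w generalizing B with
  | nil =>
    have hne : ({σ : V → Fin 3 | ∀ u, σ u ∈ B u}).Nonempty ↔ ∀ u, (B u).card ≠ 0 := by
      constructor
      · rintro ⟨σ, hσ⟩ u
        exact Finset.card_ne_zero_of_mem (hσ u)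
      · intro h
        choose σ hσ using fun u => Finset.card_ne_zero.1 (h u)
        exact ⟨σ, hσ⟩
    simp only [List.foldl_nil, alive, Multiset.map_singleton, Multiset.sum_singleton, hne,
      List.count_nil, messageCount]
    split_ifs with h
    · simp [h]
    · push Not at h
      obtain ⟨u, hu⟩ := h
      exact (Finset.prod_eq_zero (Finset.mem_univ u) (by simp [hu])).symm
  | cons v w ih =>
    have hsplit : ∀ X, ∏ u, (messageCount (Function.update B v X u).card (w.count u) : ℝ) =
        messageCount X.card (w.count v) *
          ∏ u ∈ Finset.univ.erase v, (messageCount (B u).card (w.count u) : ℝ) := fun X => by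
      rw [← Finset.mul_prod_erase _ _ (Finset.mem_univ v), Function.update_self]
      congr 1
      refine Finset.prod_congr rfl fun u hu => ?_
      rw [Function.update_of_ne (Finset.ne_of_mem_erase hu)]
    have h0 := hsplit (B v)
    rw [Function.update_eq_self] at h0
    rw [List.foldl_cons, fieldStep_pi, Fin.sum_univ_three]
    simp only [foldl_fieldStep_add, alive_add, ih, hsplit, h0]
    rw [← Finset.mul_prod_erase _ _ (Finset.mem_univ v), List.count_cons_self,
      ← sum_messageCount_erase, Fin.sum_univ_three]
    have : ∏ u ∈ Finset.univ.erase v, (messageCount (B u).card ((v :: w).count u) : ℝ) =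
        ∏ u ∈ Finset.univ.erase v, (messageCount (B u).card (w.count u) : ℝ) :=
      Finset.prod_congr rfl fun u hu => by
        rw [List.count_cons_of_ne (Finset.ne_of_mem_erase hu).symm]
    rw [this]
    push_cast
    ring

theorem rootAlive_foldl_fieldStep (w : List V) :
    rootAlive (w.foldl fieldStep {Set.univ}) = ∏ v, √√(messageCount 3 (w.count v)) := by
  have h := alive_foldl_fieldStep w fun _ => Finset.univ
  simp only [Finset.mem_univ, implies_true, Set.ofPred_true, Finset.card_univ,
    Fintype.card_fin] at h
  rw [rootAlive, h, Real.sqrt_prod _ fun _ _ => Nat.cast_nonneg _,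
    Real.sqrt_prod _ fun _ _ => Real.sqrt_nonneg _]

/-- The exponential generating function of the shifted sequence `√√(messageCount 3 (d + ·))`. -/
noncomputable def messageSeries (d : ℕ) : PowerSeries ℝ :=
  PowerSeries.mk fun k => √√(messageCount 3 (d + k)) / k.factorial

theorem derivative_messageSeries (d : ℕ) :
    PowerSeries.derivative ℝ (messageSeries d) = messageSeries (d + 1) := by
  ext k
  rw [PowerSeries.coeff_derivative, messageSeries, messageSeries, PowerSeries.coeff_mk,
    PowerSeries.coeff_mk, Nat.factorial_succ, show d + (k + 1) = d + 1 + k by ring]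
  push_cast
  field_simp

theorem derivative_prod_messageSeries (d : V → ℕ) :
    PowerSeries.derivative ℝ (∏ v, messageSeries (d v)) =
      ∑ v, ∏ u, messageSeries (d u + if u = v then 1 else 0) := by
  have key : ∀ s : Finset V, PowerSeries.derivative ℝ (∏ v ∈ s, messageSeries (d v)) =
      ∑ v ∈ s, ∏ u ∈ s, messageSeries (d u + if u = v then 1 else 0) := by
    intro s
    induction s using Finset.induction_on with
    | empty => simp
    | insert a s ha ih =>
      have hne : ∀ u ∈ s, u ≠ a := fun u hu h => ha (h ▸ hu)
      rw [Finset.prod_insert ha, Derivation.leibniz, ih, derivative_messageSeries,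
        Finset.sum_insert ha, Finset.prod_insert ha, if_pos rfl, smul_eq_mul, smul_eq_mul,
        add_comm, Finset.mul_sum, mul_comm]
      congr 1
      · congr 1
        exact Finset.prod_congr rfl fun u hu => by rw [if_neg (hne u hu), add_zero]
      · refine Finset.sum_congr rfl fun v hv => ?_
        rw [Finset.prod_insert ha, if_neg (hne v hv).symm, add_zero]
  exact key Finset.univ

theorem fieldOp_pow_foldl (j : ℕ) (w : List V) :
    (fieldOp ^ j) rootAlive (w.foldl fieldStep {Set.univ}) =
      j.factorial * PowerSeries.coeff j (∏ v, messageSeries (w.count v)) := by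
  induction j generalizing w with
  | zero =>
    rw [pow_zero, Module.End.one_apply, rootAlive_foldl_fieldStep]
    simp [messageSeries]
  | succ j ih =>
    have h : ∀ v, fieldStep (w.foldl fieldStep {Set.univ}) v =
        (w ++ [v]).foldl fieldStep {Set.univ} := fun v => by simp
    have hc : ∀ u v, (w ++ [v]).count u = w.count u + if u = v then 1 else 0 := fun u v => by
      rw [List.count_append]
      by_cases h : u = v
      · subst h; simp
      · rw [if_neg h, List.count_eq_zero_of_not_mem (a := u) (l := [v]) (by simpa using h)]
    rw [pow_succ', Module.End.mul_apply, fieldOp_apply]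
    simp only [h, ih, hc]
    rw [← Finset.mul_sum, ← map_sum, ← derivative_prod_messageSeries, PowerSeries.coeff_derivative,
      Nat.factorial_succ]
    push_cast
    ring

theorem fieldOp_pow_le (j : ℕ) {x : ℝ} (hx : 0 ≤ x) :
    (fieldOp ^ j) rootAlive {(Set.univ : Set (V → Fin 3))} * x ^ j ≤
      j.factorial *
        (∑ k ∈ Finset.range (j + 1), x ^ k / k.factorial * √√(messageCount 3 k)) ^
          Fintype.card V := by
  have h := fieldOp_pow_foldl (V := V) j []
  simp only [List.foldl_nil, List.count_nil] at h
  rw [h, mul_assoc]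
  refine mul_le_mul_of_nonneg_left ?_ (by positivity)
  rw [PowerSeries.coeff_prod, Finset.sum_mul, ← Finset.card_univ, ← Finset.prod_const,
    Finset.prod_univ_sum]
  have e : ∀ l ∈ Finset.univ.finsuppAntidiag j,
      (∏ v : V, PowerSeries.coeff (l v) (messageSeries 0)) * x ^ j =
        ∏ v : V, (x ^ l v / (l v).factorial * √√(messageCount 3 (l v))) := by
    intro l hl
    rw [Finset.mem_finsuppAntidiag] at hl
    rw [← hl.1, ← Finset.prod_pow_eq_pow_sum, ← Finset.prod_mul_distrib]
    refine Finset.prod_congr rfl fun v _ => ?_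
    rw [messageSeries, PowerSeries.coeff_mk, zero_add]
    ring
  refine (Finset.sum_congr rfl e).trans_le ?_
  rw [← Finset.sum_image (s := Finset.univ.finsuppAntidiag j) (g := fun l : V →₀ ℕ => (l : V → ℕ))
    (f := fun k : V → ℕ => ∏ v, (x ^ k v / (k v).factorial * √√(messageCount 3 (k v))))
    DFunLike.coe_injective.injOn]
  refine Finset.sum_le_sum_of_subset_of_nonneg (fun k hk => ?_) fun k _ _ =>
    Finset.prod_nonneg fun v _ => by positivity
  obtain ⟨l, hl, rfl⟩ := Finset.mem_image.1 hk
  rw [Finset.mem_finsuppAntidiag] at hl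
  refine Fintype.mem_piFinset.2 fun v => Finset.mem_range.2 (Nat.lt_succ_of_le ?_)
  rw [← hl.1]
  exact Finset.single_le_sum (f := ⇑l) (fun _ _ => Nat.zero_le _) (Finset.mem_univ v)

theorem SimpleGraph.card_colorable_mul_le (V : Type*) [Fintype V] (m : ℕ) :
    (Nat.card {G : SimpleGraph V // G.edgeSet.ncard = m ∧ G.Colorable 3} : ℝ) *
        (2 ^ m * m.factorial) ≤
      ∑ e : Fin m → V × V,
        if ∃ σ ∈ (Set.univ : Set (V → Fin 3)), ∀ i, σ (e i).1 ≠ σ (e i).2 then (1 : ℝ) else 0 := by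
  rw [Finset.sum_boole]
  set A := {G : SimpleGraph V // G.edgeSet.ncard = m ∧ G.Colorable 3}
  let B := (G : A) × (Fin m ≃ G.1.edgeSet) × (Fin m → Bool)
  let f : B → Fin m → V × V := fun x i =>
    if x.2.2 i then Quot.out (x.2.1 i).1 else (Quot.out (x.2.1 i).1).swap
  have hout : ∀ z : Sym2 V, s((Quot.out z).1, (Quot.out z).2) = z := fun z => Quot.out_eq z
  have hf : ∀ x i, s((f x i).1, (f x i).2) = (x.2.1 i).1 := by
    intro x i
    simp only [f]
    split_ifs
    · exact hout _
    · rw [Prod.fst_swap, Prod.snd_swap, Sym2.eq_swap]; exact hout _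
  have hadj : ∀ (x : B) i, x.1.1.Adj (f x i).1 (f x i).2 := fun x i => by
    rw [← SimpleGraph.mem_edgeSet, hf]; exact (x.2.1 i).2
  have hinj : Function.Injective f := by
    rintro ⟨⟨G, hG⟩, σ, b⟩ ⟨⟨G', hG'⟩, σ', b'⟩ h
    have hσ : ∀ i, (σ i).1 = (σ' i).1 := fun i => by
      have h1 := hf ⟨⟨G, hG⟩, σ, b⟩ i
      rw [h, hf] at h1
      exact h1.symm
    have hGG : G = G' := by
      rw [← SimpleGraph.edgeSet_inj]
      ext z
      constructor
      · intro hz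
        have := hσ (σ.symm ⟨z, hz⟩)
        rw [Equiv.apply_symm_apply] at this
        rw [show z = _ from this]
        exact (σ' _).2
      · intro hz
        have := hσ (σ'.symm ⟨z, hz⟩)
        rw [Equiv.apply_symm_apply] at this
        rw [show z = _ from this.symm]
        exact (σ _).2
    subst hGG
    have hσσ : σ = σ' := Equiv.ext fun i => Subtype.ext (hσ i)
    subst hσσ
    have hb : b = b' := by
      funext i
      have hi := congrFun h i
      have hne := (hadj ⟨⟨G, hG⟩, σ, b⟩ i).ne
      simp only [f] at hi hne
      cases hb : b i <;> cases hb' : b' i <;> simp [hb, hb'] at hi hne ⊢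
      · exact hne (congrArg Prod.fst hi)
      · exact hne (congrArg Prod.fst hi)
    rw [hb]
  have hcard : Fintype.card B = Fintype.card A * (2 ^ m * m.factorial) := by
    rw [Fintype.card_sigma, Finset.sum_const_nat (m := 2 ^ m * m.factorial), Finset.card_univ]
    intro G _
    have hm : Fintype.card G.1.edgeSet = m := by
      rw [← Nat.card_eq_fintype_card]; exact G.2.1
    rw [Fintype.card_prod, Fintype.card_equiv (Fintype.equivFinOfCardEq hm).symm, Fintype.card_fun,
      Fintype.card_fin, Fintype.card_bool, mul_comm]
  have hle : Fintype.card B ≤ (Finset.univ.filter fun e : Fin m → V × V =>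
      ∃ σ ∈ (Set.univ : Set (V → Fin 3)), ∀ i, σ (e i).1 ≠ σ (e i).2).card := by
    rw [← Finset.card_univ]
    refine Finset.card_le_card_of_injOn f (fun x _ => ?_) hinj.injOn
    obtain ⟨C⟩ := x.1.2.2
    simp only [Finset.coe_filter, Finset.mem_univ, true_and, Set.mem_ofPred_eq]
    exact ⟨C, Set.mem_univ _, fun i => C.valid (hadj x i)⟩
  rw [hcard] at hle
  rw [Nat.card_eq_fintype_card]
  exact_mod_cast hle

theorem SimpleGraph.choose_le_card (V : Type*) [Fintype V] (m : ℕ) :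
    ((Fintype.card V).choose 2).choose m ≤
      Nat.card {G : SimpleGraph V // G.edgeSet.ncard = m} := by
  rw [← SimpleGraph.card_edgeFinset_top_eq_card_choose_two (V := V), ← Finset.card_powersetCard,
    Nat.card_eq_fintype_card, Fintype.card_subtype]
  have h : ∀ s ∈ Finset.powersetCard m (⊤ : SimpleGraph V).edgeFinset,
      (SimpleGraph.fromEdgeSet (s : Set (Sym2 V))).edgeSet = s := by
    intro s hs
    rw [SimpleGraph.edgeSet_fromEdgeSet, sdiff_eq_left, Set.disjoint_left]
    intro z hz
    have := (Finset.mem_powersetCard.1 hs).1 hz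
    rw [SimpleGraph.mem_edgeFinset, SimpleGraph.edgeSet_top] at this
    exact this
  refine Finset.card_le_card_of_injOn (fun s => SimpleGraph.fromEdgeSet (s : Set (Sym2 V)))
    (fun s hs => ?_) fun s hs t ht hst => ?_
  · simp only [Finset.coe_filter, Finset.mem_univ, true_and, Set.mem_ofPred_eq, h s hs,
      Set.ncard_coe_finset]
    exact (Finset.mem_powersetCard.1 hs).2
  · have := congrArg SimpleGraph.edgeSet hst
    simp only [h s hs, h t ht] at this
    exact Finset.coe_injective this

end

theorem messageCount_le (b d : ℕ) (hb : b ≤ 4) : messageCount b d ≤ 4 ^ d := by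
  induction d generalizing b with
  | zero => rw [messageCount]; split_ifs <;> simp
  | succ d ih =>
    calc messageCount b (d + 1) = (4 - b) * messageCount b d + b * messageCount (b - 1) d := rfl
      _ ≤ (4 - b) * 4 ^ d + b * 4 ^ d := by
        gcongr
        · exact ih b hb
        · exact ih (b - 1) (by omega)
      _ = 4 ^ (d + 1) := by rw [← add_mul, Nat.sub_add_cancel hb, pow_succ']

theorem messageCount_closed (d : ℕ) :
    messageCount 1 d = 3 ^ d ∧ messageCount 2 d + 2 ^ d = 2 * 3 ^ d ∧
      messageCount 3 d + 3 * 2 ^ d = 3 * 3 ^ d + 1 := by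
  have h0 : ∀ d, messageCount 0 d = 0 := fun d => by
    induction d with
    | zero => rfl
    | succ d ih => simp [messageCount, ih]
  induction d with
  | zero => simp [messageCount]
  | succ d ih =>
    simp only [messageCount, h0, pow_succ, Nat.reduceSub]
    omega

theorem sqrt_sqrt_messageCount_le {k : ℕ} {p : ℝ} (hp : 0 ≤ p)
    (h : 3 * (3 : ℝ) ^ k + 1 - 3 * 2 ^ k ≤ p ^ 4 * 4 ^ k) :
    √√(messageCount 3 k) ≤ p * √2 ^ k := by
  have hq : (messageCount 3 k : ℝ) = 3 * (3 : ℝ) ^ k + 1 - 3 * 2 ^ k := by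
    rw [eq_sub_iff_add_eq]; exact_mod_cast (messageCount_closed k).2.2
  have h2 : (√2 ^ k) ^ 2 = (2 : ℝ) ^ k := by
    rw [← pow_mul, mul_comm, pow_mul, Real.sq_sqrt (by norm_num)]
  refine Real.sqrt_le_iff.2 ⟨by positivity, Real.sqrt_le_iff.2 ⟨by positivity, ?_⟩⟩
  rw [hq, mul_pow, h2, mul_pow, ← pow_mul, ← pow_mul, mul_comm k 2, pow_mul 2 2 k]
  norm_num [h]

/-- Rational upper bounds for the fourth root of the probability that `k` uniform messages leave
some colour available. -/
noncomputable def survivalBound : ℕ → ℝ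
  | 3 => 0.9757
  | 4 => 0.9355
  | 5 => 0.8871
  | 6 => 0.8356
  | 7 => 0.7837
  | 8 => 0.7330
  | 9 => 0.6844
  | 10 => 0.6384
  | 11 => 0.5949
  | 12 => 0.5542
  | _ => 1

theorem sqrt_sqrt_messageCount_le_survivalBound (k : ℕ) :
    √√(messageCount 3 k) ≤ survivalBound k * √2 ^ k := by
  have h1 : ∀ k, √√(messageCount 3 k) ≤ 1 * √2 ^ k := fun k => by
    refine sqrt_sqrt_messageCount_le zero_le_one ?_
    have h := messageCount_le 3 k (by norm_num)
    have h' := (messageCount_closed k).2.2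
    have : (messageCount 3 k : ℝ) ≤ 4 ^ k := by exact_mod_cast h
    have h2 : (messageCount 3 k : ℝ) + 3 * 2 ^ k = 3 * 3 ^ k + 1 := by exact_mod_cast h'
    linarith
  unfold survivalBound
  split
  all_goals first
    | exact h1 _
    | exact sqrt_sqrt_messageCount_le (by norm_num) (by norm_num)

theorem survivalBound_le_one (k : ℕ) : survivalBound k ≤ 1 := by
  unfold survivalBound
  split <;> norm_num

theorem survivalBound_nonneg (k : ℕ) : 0 ≤ survivalBound k := by
  unfold survivalBound
  split <;> norm_num

theorem exp_four_point_ninety_two_le : Real.exp 4.92 ≤ 137.01 := by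
  have h1 : Real.exp 1 < 2.7182818286 := Real.exp_one_lt_d9
  have h2 : (1.083286 : ℝ) ≤ Real.exp 0.08 := by
    refine le_trans ?_ (Real.sum_le_exp_of_nonneg (by norm_num) 5)
    norm_num [Finset.sum_range_succ, Nat.factorial]
  have h3 : Real.exp 4.92 * Real.exp 0.08 = Real.exp 1 ^ 5 := by
    rw [← Real.exp_add, ← Real.exp_nat_mul]; norm_num
  have h4 : Real.exp 1 ^ 5 ≤ 2.7182818286 ^ 5 := by gcongr
  have h5 : (2.7182818286 : ℝ) ^ 5 ≤ 137.01 * 1.083286 := by norm_num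
  nlinarith [Real.exp_pos 4.92]

theorem mul_exp_le_exp_mul_sqrt_sqrt :
    0.8829 * Real.exp 4.92 ≤ Real.exp (2.46 * (1 + √√(13 / 16))) := by
  have hβ : (0.9494 : ℝ) ≤ √√(13 / 16) := by
    refine Real.le_sqrt_of_sq_le (Real.le_sqrt_of_sq_le ?_)
    norm_num
  have h1 : Real.exp (-0.124476) * Real.exp 4.92 ≤ Real.exp (2.46 * (1 + √√(13 / 16))) := by
    rw [← Real.exp_add]
    exact Real.exp_le_exp.2 (by linarith)
  refine le_trans (mul_le_mul_of_nonneg_right ?_ (Real.exp_pos _).le) h1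
  have h2 := Real.exp_bound' (x := 0.124476) (by norm_num) (by norm_num) (n := 5) (by norm_num)
  have h3 : Real.exp 0.124476 ≤ 0.8829⁻¹ := by
    refine h2.trans ?_
    norm_num [Finset.sum_range_succ, Nat.factorial]
  rw [Real.exp_neg]
  exact (le_inv_comm₀ (by norm_num) (Real.exp_pos _)).2 h3

/-- The exponential growth rate of the interpolation bound is negative. -/
theorem sum_survivalBound_le (J : ℕ) :
    ∑ k ∈ Finset.range J, (4.92 : ℝ) ^ k / k.factorial * survivalBound k ≤
      0.9995 * Real.exp (2.46 * (1 + √√(13 / 16))) := by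
  have hmono : ∑ k ∈ Finset.range J, (4.92 : ℝ) ^ k / k.factorial * survivalBound k ≤
      ∑ k ∈ Finset.range (J + 13), (4.92 : ℝ) ^ k / k.factorial * survivalBound k :=
    Finset.sum_le_sum_of_subset_of_nonneg (Finset.range_mono (by omega)) fun k _ _ =>
      mul_nonneg (by positivity) (survivalBound_nonneg k)
  have hexp : ∑ k ∈ Finset.range (J + 13), (4.92 : ℝ) ^ k / k.factorial ≤ Real.exp 4.92 :=
    Real.sum_le_exp_of_nonneg (by norm_num) _
  have hdef : ∑ k ∈ Finset.range 13, (4.92 : ℝ) ^ k / k.factorial * (1 - survivalBound k) ≤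
      ∑ k ∈ Finset.range (J + 13), (4.92 : ℝ) ^ k / k.factorial * (1 - survivalBound k) :=
    Finset.sum_le_sum_of_subset_of_nonneg (Finset.range_mono (by omega)) fun k _ _ =>
      mul_nonneg (by positivity) (sub_nonneg.2 (survivalBound_le_one k))
  have hnum : (16.15 : ℝ) ≤
      ∑ k ∈ Finset.range 13, (4.92 : ℝ) ^ k / k.factorial * (1 - survivalBound k) := by
    simp only [Finset.sum_range_succ, Finset.sum_range_zero, survivalBound, Nat.factorial]
    norm_num
  simp only [mul_sub, mul_one, Finset.sum_sub_distrib] at hdef hnum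
  linarith [exp_four_point_ninety_two_le, mul_exp_le_exp_mul_sqrt_sqrt]

theorem floor_factorial_le {t : ℝ} (ht : 1 ≤ t) :
    (⌊t⌋₊.factorial : ℝ) ≤ Real.exp 2 * t * Real.exp (-t) * t ^ ⌊t⌋₊ := by
  set m := ⌊t⌋₊ with hm
  have hm1 : 1 ≤ m := Nat.one_le_floor_iff _ |>.2 ht
  have hmt : (m : ℝ) ≤ t := Nat.floor_le (by linarith)
  have htm : t < m + 1 := Nat.lt_floor_add_one t
  have hm1' : (1 : ℝ) ≤ m := by exact_mod_cast hm1
  have h := Stirling.stirlingSeq'_antitone (Nat.zero_le (m - 1))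
  simp only [Function.comp_apply, Nat.succ_eq_add_one, Nat.sub_add_cancel hm1, zero_add,
    Stirling.stirlingSeq_one] at h
  rw [Stirling.stirlingSeq, div_le_iff₀ (by positivity), Real.sqrt_mul (by norm_num)] at h
  have h2 : Real.exp 1 / √2 * (√2 * √m * (m / Real.exp 1) ^ m) =
      Real.exp 1 * √m * Real.exp (-m) * (m : ℝ) ^ m := by
    rw [div_pow, ← Real.exp_nat_mul, mul_one, Real.exp_neg]
    field_simp
  rw [h2] at h
  have h3 : √(m : ℝ) ≤ t := by
    refine le_trans (Real.sqrt_le_iff.2 ⟨by positivity, ?_⟩) hmt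
    nlinarith
  have h4 : Real.exp (-m) ≤ Real.exp 1 * Real.exp (-t) := by
    rw [← Real.exp_add]; exact Real.exp_le_exp.2 (by linarith)
  calc (m.factorial : ℝ) ≤ Real.exp 1 * √m * Real.exp (-m) * (m : ℝ) ^ m := h
    _ ≤ Real.exp 1 * t * (Real.exp 1 * Real.exp (-t)) * t ^ m := by gcongr
    _ = _ := by
      rw [show (2 : ℝ) = 1 + 1 by norm_num, Real.exp_add]; ring

section
open scoped Classical

variable {V : Type*} [Fintype V]

theorem edgeOp_pow_floor_le (hV : 1 ≤ Fintype.card V) :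
    (edgeOp ^ ⌊2.46 * (Fintype.card V : ℝ)⌋₊) rootAlive {(Set.univ : Set (V → Fin 3))} ≤
      7 * Real.exp 4 * (Fintype.card V : ℝ) ^ 2 * 0.9995 ^ Fintype.card V *
        ((Fintype.card V : ℝ) ^ 2) ^ ⌊2.46 * (Fintype.card V : ℝ)⌋₊ := by
  have hn : (1 : ℝ) ≤ Fintype.card V := by exact_mod_cast hV
  have hZ := sum_survivalBound_le
  have hE := edgeOp_pow_le (V := V)
  have hF := fieldOp_pow_le (V := V)
  set n := Fintype.card V
  set β : ℝ := √√(13 / 16) with hβ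
  have hβ0 : (0.9 : ℝ) ≤ β := by
    refine Real.le_sqrt_of_sq_le (Real.le_sqrt_of_sq_le ?_)
    norm_num
  have hβ1 : β ≤ 1 := Real.sqrt_le_one.2 (Real.sqrt_le_one.2 (by norm_num))
  set m := ⌊2.46 * (n : ℝ)⌋₊ with hm
  set r := ⌊2.46 * β * (n : ℝ)⌋₊ with hr
  have hmf : (m.factorial : ℝ) ≤ _ := floor_factorial_le (t := 2.46 * (n : ℝ)) (by linarith)
  have hrf : (r.factorial : ℝ) ≤ _ := floor_factorial_le (t := 2.46 * β * (n : ℝ)) (by nlinarith)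
  rw [← hm] at hmf
  rw [← hr] at hrf
  set T := (edgeOp ^ m) rootAlive {(Set.univ : Set (V → Fin 3))}
  set Φ := (fieldOp ^ (m + r)) rootAlive {(Set.univ : Set (V → Fin 3))}
  set Z := 0.9995 * Real.exp (2.46 * (1 + β)) with hZdef
  have h1 : ((m + r).choose m : ℝ) * (β * (n : ℝ) ^ 2) ^ r * T ≤ (√2 * n) ^ (m + r) * Φ :=
    hE m r {Set.univ}
  have h2 : Φ * (√2 * 2.46) ^ (m + r) ≤ (m + r).factorial * Z ^ n := by
    refine (hF (m + r) (x := √2 * 2.46) (by positivity)).trans ?_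
    gcongr
    refine le_trans (Finset.sum_le_sum fun k _ => ?_) (hZ _)
    calc (√2 * 2.46) ^ k / k.factorial * √√(messageCount 3 k)
        ≤ (√2 * 2.46) ^ k / k.factorial * (survivalBound k * √2 ^ k) := by
          gcongr
          exact sqrt_sqrt_messageCount_le_survivalBound k
      _ = (√2 * √2 * 2.46) ^ k / k.factorial * survivalBound k := by
          rw [mul_pow, mul_pow, mul_pow]; ring
      _ = _ := by rw [Real.mul_self_sqrt (by norm_num)]; norm_num
  have hfac : ((m + r).choose m : ℝ) * (m.factorial * r.factorial) = (m + r).factorial := by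
    rw [← mul_assoc, Nat.choose_symm_add]
    exact_mod_cast Nat.add_choose_mul_factorial_mul_factorial m r
  have hc : (0 : ℝ) < (m + r).choose m := by
    exact_mod_cast Nat.choose_pos (Nat.le_add_right m r)
  have h3 : (β * (n : ℝ) ^ 2) ^ r * 2.46 ^ (m + r) * T ≤
      (n : ℝ) ^ (m + r) * (m.factorial * r.factorial) * Z ^ n := by
    refine le_of_mul_le_mul_left ?_ (mul_pos hc (pow_pos (Real.sqrt_pos.2 two_pos) (m + r)))
    calc _ = (((m + r).choose m : ℝ) * (β * (n : ℝ) ^ 2) ^ r * T) * (√2 * 2.46) ^ (m + r) := by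
          rw [mul_pow √2]; ring
      _ ≤ (√2 * n) ^ (m + r) * Φ * (√2 * 2.46) ^ (m + r) := by gcongr
      _ = (√2 * n) ^ (m + r) * (Φ * (√2 * 2.46) ^ (m + r)) := by ring
      _ ≤ (√2 * n) ^ (m + r) * ((m + r).factorial * Z ^ n) := by gcongr
      _ = _ := by rw [← hfac, mul_pow √2]; ring
  have hexp : Real.exp (-(2.46 * (n : ℝ))) * Real.exp (-(2.46 * β * n)) * Z ^ n = 0.9995 ^ n := by
    rw [hZdef, mul_pow, ← Real.exp_nat_mul, mul_left_comm, ← Real.exp_add, ← Real.exp_add]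
    rw [show -(2.46 * (n : ℝ)) + -(2.46 * β * n) + n * (2.46 * (1 + β)) = 0 by ring]
    simp
  have h4 : (β * (n : ℝ) ^ 2) ^ r * 2.46 ^ (m + r) * T ≤
      (β * (n : ℝ) ^ 2) ^ r * 2.46 ^ (m + r) *
        (7 * Real.exp 4 * (n : ℝ) ^ 2 * 0.9995 ^ n * ((n : ℝ) ^ 2) ^ m) :=
    calc _ ≤ (n : ℝ) ^ (m + r) * ((Real.exp 2 * (2.46 * n) * Real.exp (-(2.46 * (n : ℝ))) *
            (2.46 * n) ^ m) * (Real.exp 2 * (2.46 * β * n) * Real.exp (-(2.46 * β * n)) *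
            (2.46 * β * n) ^ r)) * Z ^ n := by
          refine h3.trans ?_
          gcongr
      _ = (β * (n : ℝ) ^ 2) ^ r * 2.46 ^ (m + r) * ((2.46 * (2.46 * β)) *
            (Real.exp 2 * Real.exp 2) * (n : ℝ) ^ 2 * (Real.exp (-(2.46 * (n : ℝ))) *
            Real.exp (-(2.46 * β * n)) * Z ^ n) * ((n : ℝ) ^ 2) ^ m) := by
          simp only [mul_pow, pow_add, ← pow_mul]; ring
      _ ≤ _ := by
          rw [hexp, ← Real.exp_add, show (2 : ℝ) + 2 = 4 by norm_num]
          gcongr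
          linarith
  exact le_of_mul_le_mul_left h4 (by positivity)

theorem card_colorable_mul_le_of_floor_le (hV : 1 ≤ Fintype.card V) {m : ℕ}
    (hm : ⌊2.46 * (Fintype.card V : ℝ)⌋₊ ≤ m) :
    (Nat.card {G : SimpleGraph V // G.edgeSet.ncard = m ∧ G.Colorable 3} : ℝ) *
        (2 ^ m * m.factorial) ≤
      7 * Real.exp 4 * (Fintype.card V : ℝ) ^ 2 * 0.9995 ^ Fintype.card V *
        ((Fintype.card V : ℝ) ^ 2) ^ m := by
  refine (SimpleGraph.card_colorable_mul_le V m).trans ?_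
  refine (le_of_eq ?_).trans (b := (edgeOp ^ m) rootAlive {(Set.univ : Set (V → Fin 3))}) ?_
  · rw [edgeOp_pow_singleton]
    congr!
  obtain ⟨k, rfl⟩ := Nat.exists_eq_add_of_le hm
  refine (edgeOp_pow_add_le _ k _).trans ?_
  refine (mul_le_mul_of_nonneg_left (edgeOp_pow_floor_le hV) (by positivity)).trans_eq ?_
  rw [pow_add, pow_mul]
  ring

theorem pow_card_sq_le_card_mul {K : ℝ} {m : ℕ} (hK : 0 ≤ K)
    (hmK : (m : ℝ) ≤ K * Fintype.card V)
    (hV : 2 * (1 + 2 * K) ≤ Fintype.card V) (hm : m ≤ (Fintype.card V).choose 2) :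
    ((Fintype.card V : ℝ) ^ 2) ^ m ≤ Real.exp (2 * (1 + 2 * K) * K) *
      (Nat.card {G : SimpleGraph V // G.edgeSet.ncard = m} * (2 ^ m * m.factorial)) := by
  have hB : ((((Fintype.card V).choose 2).choose m : ℕ) : ℝ) ≤ _ :=
    Nat.cast_le.2 (SimpleGraph.choose_le_card V m)
  set n := Fintype.card V
  have hn : (0 : ℝ) < n := by linarith
  set N := n.choose 2
  have hN : (N : ℝ) = n * (n - 1) / 2 := Nat.cast_choose_two ℝ n
  have h1 : (N + 1 - m) ^ m ≤ N.choose m * m.factorial := by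
    rw [mul_comm, ← Nat.descFactorial_eq_factorial_mul_choose]
    exact Nat.pow_sub_le_descFactorial N m
  have h1' : ((N : ℝ) + 1 - m) ^ m ≤ N.choose m * m.factorial := by
    have : ((N + 1 - m : ℕ) : ℝ) = N + 1 - m := by rw [Nat.cast_sub (by omega)]; push_cast; ring
    rw [← this]
    exact_mod_cast h1
  set t := (1 + 2 * K) / n with ht
  have htn : t * n = 1 + 2 * K := div_mul_cancel₀ _ hn.ne'
  have ht0 : 0 ≤ t := by positivity
  have ht2 : t ≤ 1 / 2 := by rw [ht, div_le_iff₀ hn]; linarith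
  have h2 : 1 ≤ Real.exp (2 * t) * (1 - t) := by
    nlinarith [Real.add_one_le_exp (2 * t)]
  have h3 : (n : ℝ) ^ 2 * (1 - t) ≤ 2 * (N + 1 - m) := by
    rw [hN]
    nlinarith
  calc ((n : ℝ) ^ 2) ^ m ≤ (Real.exp (2 * t) * ((n : ℝ) ^ 2 * (1 - t))) ^ m := by
        gcongr
        nlinarith [sq_nonneg (n : ℝ)]
    _ = Real.exp (m * (2 * t)) * ((n : ℝ) ^ 2 * (1 - t)) ^ m := by
        rw [mul_pow, ← Real.exp_nat_mul]
    _ ≤ Real.exp (2 * (1 + 2 * K) * K) * (2 * (N + 1 - m)) ^ m := by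
        have : 0 ≤ (n : ℝ) ^ 2 * (1 - t) := mul_nonneg (by positivity) (by linarith)
        gcongr ?_ * ?_
        · exact Real.exp_le_exp.2 (by nlinarith)
        · gcongr
    _ ≤ _ := by
        rw [mul_pow]
        gcongr Real.exp _ * ?_
        calc (2 : ℝ) ^ m * (N + 1 - m) ^ m ≤ 2 ^ m * (N.choose m * m.factorial) := by gcongr
          _ = N.choose m * (2 ^ m * m.factorial) := by ring
          _ ≤ _ := by gcongr

end

theorem card_colorable_div_card_le {K : ℝ} {n m : ℕ} (hK : 0 ≤ K) (hmK : (m : ℝ) ≤ K * n)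
    (hn : 2 * (1 + 2 * K) ≤ n) (hm : m ≤ n * (n - 1) / 2) (hm' : ⌊2.46 * (n : ℝ)⌋₊ ≤ m) :
    (Nat.card {G : SimpleGraph (Fin n) // G.edgeSet.ncard = m ∧ G.Colorable 3} : ℝ) /
        (Nat.card {G : SimpleGraph (Fin n) // G.edgeSet.ncard = m} : ℝ) ≤
      7 * Real.exp 4 * Real.exp (2 * (1 + 2 * K) * K) * ((n : ℝ) ^ 2 * 0.9995 ^ n) := by
  have hn1 : 1 ≤ n := by
    have : (1 : ℝ) ≤ n := by linarith
    exact_mod_cast this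
  have h1 := card_colorable_mul_le_of_floor_le (V := Fin n) (m := m) (by simpa using hn1)
    (by simpa using hm')
  have h2 := pow_card_sq_le_card_mul (V := Fin n) (m := m) hK (by simpa using hmK)
    (by simpa using hn) (by rw [Fintype.card_fin, Nat.choose_two_right]; exact hm)
  simp only [Fintype.card_fin] at h1 h2
  refine div_le_of_le_mul₀ (Nat.cast_nonneg _) (by positivity) ?_
  refine le_of_mul_le_mul_right (h1.trans ?_) (by positivity : (0 : ℝ) < 2 ^ m * m.factorial)
  refine (mul_le_mul_of_nonneg_left h2 (by positivity)).trans_eq ?_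
  ring

/-- For every real `c ≥ 2.468155` and every sequence `(m_n)` with `m_n / n → c` and
`m_n ≤ n (n-1) / 2`, the proportion of simple graphs on `Fin n` having exactly `m_n`
edges that are 3-colourable tends to `0`. -/
theorem stmt1 (c : ℝ) (hc : 2.468155 ≤ c) (m : ℕ → ℕ)
    (hm : Tendsto (fun n => (m n : ℝ) / n) atTop (nhds c))
    (hle : ∀ n, m n ≤ n * (n - 1) / 2) :
    Tendsto (fun n =>
      (Nat.card {G : SimpleGraph (Fin n) // G.edgeSet.ncard = m n ∧ G.Colorable 3} : ℝ) /
        (Nat.card {G : SimpleGraph (Fin n) // G.edgeSet.ncard = m n} : ℝ))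
      atTop (nhds 0) := by
  have hlim : Tendsto (fun n : ℕ => 7 * Real.exp 4 * Real.exp (2 * (1 + 2 * (c + 1)) * (c + 1)) *
      ((n : ℝ) ^ 2 * 0.9995 ^ n)) atTop (nhds 0) := by
    have h := tendsto_pow_const_mul_const_pow_of_abs_lt_one 2 (r := 0.9995)
      (by rw [abs_of_pos] <;> norm_num)
    simpa using h.const_mul (7 * Real.exp 4 * Real.exp (2 * (1 + 2 * (c + 1)) * (c + 1)))
  refine squeeze_zero' (Eventually.of_forall fun n => by positivity) ?_ hlim
  filter_upwards [hm.eventually_const_lt (show 2.46 < c by linarith),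
    hm.eventually_lt_const (show c < c + 1 by linarith),
    tendsto_natCast_atTop_atTop.eventually_ge_atTop (2 * (1 + 2 * (c + 1)))] with n h1 h2 h3
  have hn : (0 : ℝ) < n := by linarith
  rw [lt_div_iff₀ hn] at h1
  rw [div_lt_iff₀ hn] at h2
  exact card_colorable_div_card_le (by linarith) h2.le h3 (hle n)
    (Nat.floor_le_of_le h1.le)
end

section
/- Let c > 0, set λ = 2c, let (m_n) be a sequence of natural numbers with m_n/n → c, and fix ε > 0 and x_max ∈ ℕ. For G : Fin m_n → Fin n × Fin n define X_n(G) = R(G) if |θ_x(G) − p(x,λ)| ≤ ε for every 0 ≤ x ≤ x_max, and X_n(G) = 0 otherwise. If the expectation of X_n over a uniformly random G tends to 0 as n → ∞, then the probability that a uniformly random G : Fin m_n → Fin n × Fin n admits a proper 3-colouring tends to 0 as n → ∞. -/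
open Filter
open scoped Classical

/-- The Poisson probability `p(x, λ) = e^(−λ) λ^x / x!`. -/
noncomputable def poisson (lam : ℝ) (x : ℕ) : ℝ :=
  Real.exp (-lam) * lam ^ x / (Nat.factorial x)

/-- The degree of the vertex `v` in the multigraph `G`. -/
def deg {n m : ℕ} (G : Fin m → Fin n × Fin n) (v : Fin n) : ℕ :=
  (Finset.univ.filter fun e => (G e).1 = v).card +
    (Finset.univ.filter fun e => (G e).2 = v).card

/-- `θ_x(G)`: `1/n` times the number of vertices of `G` of degree `x`. -/
noncomputable def theta {n m : ℕ} (G : Fin m → Fin n × Fin n) (x : ℕ) : ℝ :=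
  ((Finset.univ.filter fun v => deg G v = x).card : ℝ) / n

/-- A proper 3-colouring of the multigraph `G`. -/
def Proper {n m : ℕ} (G : Fin m → Fin n × Fin n) (σ : Fin n → Fin 3) : Prop :=
  ∀ e, σ (G e).1 ≠ σ (G e).2

/-- `v` and `w` are joined by an edge of `G`. -/
def Adj {n m : ℕ} (G : Fin m → Fin n × Fin n) (v w : Fin n) : Prop :=
  ∃ e, G e = (v, w) ∨ G e = (w, v)

/-- A colouring is rigid if every vertex of colour 0 is joined to at least one vertex of
colour 1 and at least one of colour 2, and every vertex of colour 1 is joined to at least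
one vertex of colour 2. -/
def Rigid {n m : ℕ} (G : Fin m → Fin n × Fin n) (σ : Fin n → Fin 3) : Prop :=
  (∀ v, σ v = 0 → (∃ w, Adj G v w ∧ σ w = 1) ∧ (∃ w, Adj G v w ∧ σ w = 2)) ∧
    (∀ v, σ v = 1 → ∃ w, Adj G v w ∧ σ w = 2)

/-- `R(G)`: the number of rigid proper 3-colourings of `G`. -/
noncomputable def R {n m : ℕ} (G : Fin m → Fin n × Fin n) : ℕ :=
  Nat.card {σ : Fin n → Fin 3 // Proper G σ ∧ Rigid G σ}

/-- A proper colouring with maximal colour sum is rigid. -/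
theorem exists_rigid_of_proper {n m : ℕ} (G : Fin m → Fin n × Fin n)
    (h : ∃ σ : Fin n → Fin 3, Proper G σ) :
    ∃ σ : Fin n → Fin 3, Proper G σ ∧ Rigid G σ := by
  obtain ⟨σ, hσ, hmax⟩ := Finset.exists_max_image
    (Finset.univ.filter fun σ : Fin n → Fin 3 => Proper G σ)
    (fun σ => ∑ v, (σ v : ℕ)) (by simpa [Finset.Nonempty] using h)
  simp only [Finset.mem_filter, Finset.mem_univ, true_and] at hσ hmax
  have key : ∀ v (a : Fin 3), σ v < a → ∃ w, Adj G v w ∧ σ w = a := by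
    intro v a hva
    by_contra! hno
    have hproper : Proper G (Function.update σ v a) := by
      intro e
      have he := hσ e
      have h1 := hno (G e).2
      have h2 := hno (G e).1
      by_cases hv : (G e).1 = v <;> by_cases hw : (G e).2 = v
      · exact absurd (by rw [hv, hw]) he
      · simpa [Function.update_apply, hv, hw] using
          (h1 ⟨e, Or.inl (Prod.ext hv rfl)⟩).symm
      · simpa [Function.update_apply, hv, hw] using
          h2 ⟨e, Or.inr (Prod.ext rfl hw)⟩
      · simpa [Function.update_apply, hv, hw] using he
    have hlt : ∑ w, (σ w : ℕ) < ∑ w, (Function.update σ v a w : ℕ) := by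
      refine Finset.sum_lt_sum (fun w _ => ?_) ⟨v, Finset.mem_univ v, by simpa using hva⟩
      rcases eq_or_ne w v with rfl | hw
      · simpa using hva.le
      · simp [hw]
    exact absurd (hmax _ hproper) (not_le.mpr hlt)
  refine ⟨σ, hσ, fun v hv => ⟨key v 1 (by simp [hv]), key v 2 (by simp [hv])⟩,
    fun v hv => key v 2 (by rw [hv]; decide)⟩

theorem one_le_R_of_exists_proper {n m : ℕ} (G : Fin m → Fin n × Fin n)
    (h : ∃ σ : Fin n → Fin 3, Proper G σ) : 1 ≤ R G := by
  obtain ⟨σ, hσ⟩ := exists_rigid_of_proper G h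
  have : Nonempty {σ : Fin n → Fin 3 // Proper G σ ∧ Rigid G σ} := ⟨⟨σ, hσ⟩⟩
  exact Nat.card_pos

section Occupancy

variable {ι α : Type*} [Fintype ι] [Fintype α] [DecidableEq ι] [DecidableEq α]

theorem card_functions_fiber_card_eq (v : α) (x : ℕ) :
    (Finset.univ.filter fun f : ι → α =>
        (Finset.univ.filter fun i => f i = v).card = x).card =
      (Fintype.card ι).choose x * (Fintype.card α - 1) ^ (Fintype.card ι - x) := by
  rw [Finset.card_eq_sum_card_fiberwise (f := fun f : ι → α => Finset.univ.filter fun i => f i = v)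
    (t := Finset.powersetCard x Finset.univ)]
  · rw [Finset.sum_congr rfl (g := fun _ => (Fintype.card α - 1) ^ (Fintype.card ι - x))]
    · simp [Finset.card_powersetCard]
    · intro S hS
      rw [Finset.mem_powersetCard] at hS
      have : ((Finset.univ.filter fun f : ι → α =>
          (Finset.univ.filter fun i => f i = v).card = x).filter fun f =>
            (Finset.univ.filter fun i => f i = v) = S) =
          Fintype.piFinset fun i => if i ∈ S then {v} else {v}ᶜ := by
        ext f
        simp only [Finset.mem_filter, Finset.mem_univ, true_and, Fintype.mem_piFinset]
        constructor
        · rintro ⟨-, rfl⟩ i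
          by_cases hi : f i = v <;> simp [hi]
        · intro h
          have hfS : (Finset.univ.filter fun i => f i = v) = S := by
            ext i
            have := h i
            by_cases hi : i ∈ S <;> simp_all
          exact ⟨hfS ▸ hS.2, hfS⟩
      rw [this, Fintype.card_piFinset]
      have h2 : ∀ i, (if i ∈ S then ({v} : Finset α) else {v}ᶜ).card =
          if i ∈ S then 1 else Fintype.card α - 1 := by
        intro i; split_ifs <;> simp [Finset.card_compl]
      simp only [h2]
      rw [Finset.prod_ite, Finset.prod_const_one, one_mul, Finset.prod_const,
        Finset.filter_not, Finset.card_sdiff]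
      simp [hS.2]
  · intro f hf
    simpa [Finset.mem_powersetCard] using hf

theorem card_functions_two_fibers_card_eq {u v : α} (huv : u ≠ v) (x : ℕ) :
    (Finset.univ.filter fun f : ι → α =>
        (Finset.univ.filter fun i => f i = u).card = x ∧
          (Finset.univ.filter fun i => f i = v).card = x).card =
      (Fintype.card ι).choose x * (Fintype.card ι - x).choose x *
        (Fintype.card α - 2) ^ (Fintype.card ι - x - x) := by
  rw [Finset.card_eq_sum_card_fiberwise
    (f := fun f : ι → α => (⟨Finset.univ.filter fun i => f i = u,
      Finset.univ.filter fun i => f i = v⟩ : (_ : Finset ι) × Finset ι))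
    (t := (Finset.powersetCard x Finset.univ).sigma fun S => Finset.powersetCard x Sᶜ)]
  · rw [Finset.sum_congr rfl (g := fun _ => (Fintype.card α - 2) ^ (Fintype.card ι - x - x))]
    · rw [Finset.sum_const, Finset.card_sigma, Finset.sum_congr rfl
        (g := fun _ => (Fintype.card ι - x).choose x)]
      · simp [Finset.card_powersetCard]
      · intro S hS
        rw [Finset.mem_powersetCard] at hS
        simp [Finset.card_powersetCard, Finset.card_compl, hS.2]
    · rintro ⟨S, T⟩ hST
      simp only [Finset.mem_sigma, Finset.mem_powersetCard] at hST
      obtain ⟨⟨-, hS⟩, hTS, hT⟩ := hST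
      have hdisj : ∀ i ∈ T, i ∉ S := fun i hi => by simpa using hTS hi
      have : ((Finset.univ.filter fun f : ι → α =>
          (Finset.univ.filter fun i => f i = u).card = x ∧
            (Finset.univ.filter fun i => f i = v).card = x).filter fun f =>
            (⟨Finset.univ.filter fun i => f i = u,
              Finset.univ.filter fun i => f i = v⟩ : (_ : Finset ι) × Finset ι) = ⟨S, T⟩) =
          Fintype.piFinset fun i =>
            if i ∈ S then {u} else if i ∈ T then {v} else {u, v}ᶜ := by
        ext f
        simp only [Finset.mem_filter, Finset.mem_univ, true_and, Fintype.mem_piFinset,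
          Sigma.mk.injEq, heq_eq_eq]
        constructor
        · rintro ⟨-, rfl, rfl⟩ i
          by_cases hi : f i = u <;> by_cases hj : f i = v <;> simp [hi, hj, huv.symm]
        · intro h
          have hfS : (Finset.univ.filter fun i => f i = u) = S := by
            ext i
            have := h i
            by_cases hi : i ∈ S <;> by_cases hj : i ∈ T <;> simp_all [huv.symm]
          have hfT : (Finset.univ.filter fun i => f i = v) = T := by
            ext i
            have := h i
            have := hdisj i
            by_cases hi : i ∈ S <;> by_cases hj : i ∈ T <;> simp_all
          exact ⟨⟨hfS ▸ hS, hfT ▸ hT⟩, hfS, hfT⟩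
      rw [this, Fintype.card_piFinset]
      have h2 : ∀ i, (if i ∈ S then ({u} : Finset α) else if i ∈ T then {v} else {u, v}ᶜ).card =
          if i ∈ S ∪ T then 1 else Fintype.card α - 2 := by
        intro i
        have hpair : (({u, v} : Finset α)ᶜ).card = Fintype.card α - 2 := by
          rw [Finset.card_compl, Finset.card_pair huv]
        by_cases hi : i ∈ S
        · simp [hi]
        · by_cases hj : i ∈ T
          · simp [hi, hj]
          · rw [if_neg hi, if_neg hj, if_neg (by simp [hi, hj]), hpair]
      simp only [h2]
      have hcard : (S ∪ T).card = x + x := by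
        rw [Finset.card_union_of_disjoint
          (Finset.disjoint_left.mpr fun i hi hj => hdisj i hj hi), hS, hT]
      rw [Finset.prod_ite, Finset.prod_const_one, one_mul, Finset.prod_const,
        ← Finset.compl_filter, Finset.filter_mem_eq_inter, Finset.univ_inter, Finset.card_compl,
        hcard, Nat.sub_sub]
  · intro f hf
    simp only [Finset.coe_filter, Finset.mem_univ, true_and, Set.mem_ofPred_eq] at hf
    simp only [Finset.coe_sigma, Set.mem_sigma_iff, Finset.mem_coe, Finset.mem_powersetCard,
      Finset.subset_univ, true_and, hf, and_true]
    intro i hi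
    simp only [Finset.mem_filter, Finset.mem_univ, true_and, Finset.mem_compl] at hi ⊢
    rw [hi]
    exact huv.symm

end Occupancy

/-- A multigraph as the function listing the two endpoints of each edge. -/
def endpointsEquiv (n m : ℕ) : (Fin m → Fin n × Fin n) ≃ (Fin m ⊕ Fin m → Fin n) :=
  (Equiv.arrowProdEquivProdArrow (Fin m) (fun _ => Fin n) (fun _ => Fin n)).trans
    (Equiv.sumArrowEquivProdArrow (Fin m) (Fin m) (Fin n)).symm

theorem deg_eq_card_endpoints {n m : ℕ} (G : Fin m → Fin n × Fin n) (v : Fin n) :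
    deg G v = (Finset.univ.filter fun i => endpointsEquiv n m G i = v).card := by
  simp only [deg, Finset.card_filter, Fintype.sum_sum_type]
  rfl

theorem card_deg_eq {n m : ℕ} (v : Fin n) (x : ℕ) :
    (Finset.univ.filter fun G : Fin m → Fin n × Fin n => deg G v = x).card =
      (2 * m).choose x * (n - 1) ^ (2 * m - x) := by
  have h := card_functions_fiber_card_eq (ι := Fin m ⊕ Fin m) v x
  simp only [Fintype.card_sum, Fintype.card_fin, ← two_mul] at h
  rw [← h]
  exact Finset.card_equiv (endpointsEquiv n m) fun G => by simp [deg_eq_card_endpoints]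

theorem card_deg_eq_and_deg_eq {n m : ℕ} {u v : Fin n} (huv : u ≠ v) (x : ℕ) :
    (Finset.univ.filter fun G : Fin m → Fin n × Fin n => deg G u = x ∧ deg G v = x).card =
      (2 * m).choose x * (2 * m - x).choose x * (n - 2) ^ (2 * m - x - x) := by
  have h := card_functions_two_fibers_card_eq (ι := Fin m ⊕ Fin m) huv x
  simp only [Fintype.card_sum, Fintype.card_fin, ← two_mul] at h
  rw [← h]
  exact Finset.card_equiv (endpointsEquiv n m) fun G => by simp [deg_eq_card_endpoints]

theorem sum_card_deg_eq {n m : ℕ} (x : ℕ) :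
    ∑ G : Fin m → Fin n × Fin n, ((Finset.univ.filter fun v => deg G v = x).card : ℝ) =
      n * ((2 * m).choose x * (n - 1) ^ (2 * m - x) : ℕ) := by
  simp only [Finset.card_filter, Nat.cast_sum]
  rw [Finset.sum_comm]
  simp only [← Nat.cast_sum, ← Finset.card_filter, card_deg_eq]
  simp

theorem sum_card_deg_eq_sq {n m : ℕ} (x : ℕ) :
    ∑ G : Fin m → Fin n × Fin n, ((Finset.univ.filter fun v => deg G v = x).card : ℝ) ^ 2 =
      n * ((2 * m).choose x * (n - 1) ^ (2 * m - x) : ℕ) +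
        n * (n - 1) * ((2 * m).choose x * (2 * m - x).choose x *
          (n - 2) ^ (2 * m - x - x) : ℕ) := by
  have hsq : ∀ G : Fin m → Fin n × Fin n,
      ((Finset.univ.filter fun v => deg G v = x).card : ℝ) ^ 2 =
        ∑ u, ∑ v, if deg G u = x ∧ deg G v = x then (1 : ℝ) else 0 := by
    intro G
    rw [sq, Finset.card_filter, Nat.cast_sum, Finset.sum_mul_sum]
    refine Finset.sum_congr rfl fun u _ => Finset.sum_congr rfl fun v _ => ?_
    by_cases hu : deg G u = x <;> by_cases hv : deg G v = x <;> simp [hu, hv]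
  simp only [hsq]
  rw [Finset.sum_comm]
  have hinner : ∀ u : Fin n, ∑ G : Fin m → Fin n × Fin n,
      ∑ v, (if deg G u = x ∧ deg G v = x then (1 : ℝ) else 0) =
        ((2 * m).choose x * (n - 1) ^ (2 * m - x) : ℕ) +
          (n - 1) * ((2 * m).choose x * (2 * m - x).choose x *
            (n - 2) ^ (2 * m - x - x) : ℕ) := by
    intro u
    rw [Finset.sum_comm, ← Finset.add_sum_erase _ _ (Finset.mem_univ u)]
    congr 1
    · simp only [and_self, Finset.sum_boole, card_deg_eq]
    · rw [Finset.sum_congr rfl (g := fun _ => (((2 * m).choose x * (2 * m - x).choose x *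
            (n - 2) ^ (2 * m - x - x) : ℕ) : ℝ))]
      · have hn : 1 ≤ n := u.pos
        rw [Finset.sum_const, Finset.card_erase_of_mem (Finset.mem_univ u), nsmul_eq_mul]
        simp [Nat.cast_sub hn]
      · intro v hv
        rw [Finset.sum_boole, card_deg_eq_and_deg_eq (Finset.ne_of_mem_erase hv).symm]
  simp only [hinner, Finset.sum_const, Finset.card_univ, Fintype.card_fin, nsmul_eq_mul]
  ring

section Asymptotics

variable {N : ℕ → ℕ} {lam : ℝ}

theorem tendsto_sub_div (hN : Tendsto (fun n => (N n : ℝ) / n) atTop (nhds lam)) (k : ℕ) :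
    Tendsto (fun n => ((N n - k : ℕ) : ℝ) / n) atTop (nhds lam) := by
  have h1 : Tendsto (fun n : ℕ => (N n : ℝ) / n - (k : ℝ) / n) atTop (nhds lam) := by
    simpa using hN.sub (tendsto_const_div_atTop_nhds_zero_nat (k : ℝ))
  refine tendsto_of_tendsto_of_tendsto_of_le_of_le h1 hN (fun n => ?_) (fun n => ?_)
  · rw [← sub_div]
    have : (N n : ℝ) ≤ ((N n - k : ℕ) : ℝ) + k := by exact_mod_cast (by omega)
    exact div_le_div_of_nonneg_right (by linarith) (Nat.cast_nonneg n)
  · exact div_le_div_of_nonneg_right (Nat.cast_le.mpr (Nat.sub_le _ _)) (Nat.cast_nonneg n)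

theorem tendsto_choose_div_pow (hN : Tendsto (fun n => (N n : ℝ) / n) atTop (nhds lam)) (x : ℕ) :
    Tendsto (fun n => ((N n).choose x : ℝ) / (n : ℝ) ^ x) atTop
      (nhds (lam ^ x / x.factorial)) := by
  have h : Tendsto (fun n : ℕ => (∏ i ∈ Finset.range x, ((N n - i : ℕ) : ℝ) / n) / x.factorial)
      atTop (nhds ((∏ _i ∈ Finset.range x, lam) / x.factorial)) :=
    (tendsto_finsetProd _ fun i _ => tendsto_sub_div hN i).div_const _
  rw [Finset.prod_const, Finset.card_range] at h
  refine h.congr fun n => ?_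
  have hx : (x.factorial : ℝ) ≠ 0 := by exact_mod_cast x.factorial_ne_zero
  rw [Finset.prod_div_distrib, Finset.prod_const, Finset.card_range, ← Nat.cast_prod,
    ← Nat.descFactorial_eq_prod_range, Nat.descFactorial_eq_factorial_mul_choose]
  push_cast
  field_simp

theorem tendsto_sub_div_pow (hN : Tendsto (fun n => (N n : ℝ) / n) atTop (nhds lam)) (k : ℕ) :
    Tendsto (fun n : ℕ => (((n - k : ℕ) : ℝ) / n) ^ N n) atTop
      (nhds (Real.exp (-(k * lam)))) := by
  have h1 : Tendsto (fun n : ℕ => (n : ℝ) * Real.log (1 + -(k : ℝ) / n)) atTop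
      (nhds (-(k : ℝ))) :=
    (Real.tendsto_mul_log_one_add_div_atTop (-(k : ℝ))).comp tendsto_natCast_atTop_atTop
  have h2 := (Real.continuous_exp.tendsto _).comp (hN.mul h1)
  rw [show lam * -(k : ℝ) = -(k * lam) by ring] at h2
  refine h2.congr' ?_
  filter_upwards [eventually_gt_atTop k] with n hn
  have hn0 : (0 : ℝ) < n := by exact_mod_cast (by omega)
  have hk : (k : ℝ) < n := by exact_mod_cast hn
  have heq : (1 + -(k : ℝ) / n) = ((n - k : ℕ) : ℝ) / n := by
    rw [Nat.cast_sub hn.le]; field_simp; ring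
  have hpos : 0 < ((n - k : ℕ) : ℝ) / n := by
    rw [Nat.cast_sub hn.le]; exact div_pos (by linarith) hn0
  simp only [Function.comp_apply]
  rw [heq, ← mul_assoc, div_mul_cancel₀ _ hn0.ne', ← Real.log_pow, Real.exp_log (pow_pos hpos _)]

theorem tendsto_one_degree_prob (hN : Tendsto (fun n => (N n : ℝ) / n) atTop (nhds lam)) (x : ℕ) :
    Tendsto (fun n => (((N n).choose x * (n - 1) ^ (N n - x) : ℕ) : ℝ) / (n : ℝ) ^ N n) atTop
      (nhds (poisson lam x)) := by
  have h := (tendsto_choose_div_pow hN x).mul (tendsto_sub_div_pow (tendsto_sub_div hN x) 1)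
  have hp : lam ^ x / x.factorial * Real.exp (-((1 : ℕ) * lam)) = poisson lam x := by
    simp only [poisson, Nat.cast_one, one_mul]; ring
  rw [hp] at h
  refine h.congr fun n => ?_
  rcases lt_or_ge (N n) x with hlt | hle
  · simp [Nat.choose_eq_zero_of_lt hlt]
  · rw [div_pow, div_mul_div_comm, ← pow_add, Nat.add_sub_cancel' hle]
    push_cast
    rfl

theorem tendsto_two_degree_prob (hN : Tendsto (fun n => (N n : ℝ) / n) atTop (nhds lam)) (x : ℕ) :
    Tendsto (fun n => (((N n).choose x * (N n - x).choose x * (n - 2) ^ (N n - x - x) : ℕ) : ℝ) /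
      (n : ℝ) ^ N n) atTop (nhds (poisson lam x ^ 2)) := by
  have hN' := tendsto_sub_div hN x
  have h := ((tendsto_choose_div_pow hN x).mul (tendsto_choose_div_pow hN' x)).mul
    (tendsto_sub_div_pow (tendsto_sub_div hN' x) 2)
  have hp : lam ^ x / x.factorial * (lam ^ x / x.factorial) * Real.exp (-((2 : ℕ) * lam)) =
      poisson lam x ^ 2 := by
    rw [show -(((2 : ℕ) : ℝ) * lam) = -lam + -lam by push_cast; ring, Real.exp_add, poisson]
    ring
  rw [hp] at h
  refine h.congr fun n => ?_
  rcases lt_or_ge (N n) (x + x) with hlt | hle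
  · simp [Nat.choose_eq_zero_of_lt (show N n - x < x by omega)]
  · rw [div_pow, div_mul_div_comm, div_mul_div_comm, ← pow_add, ← pow_add,
      show x + x + (N n - x - x) = N n by omega]
    push_cast
    rfl

end Asymptotics

/-- The mean squared deviation of `θ_x` from the Poisson probability vanishes. -/
theorem tendsto_sum_theta_sub_poisson_sq {c : ℝ} {m : ℕ → ℕ}
    (hm : Tendsto (fun n => (m n : ℝ) / n) atTop (nhds c)) (x : ℕ) :
    Tendsto (fun n => (∑ G : Fin (m n) → Fin n × Fin n, (theta G x - poisson (2 * c) x) ^ 2) /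
      (n : ℝ) ^ (2 * m n)) atTop (nhds 0) := by
  set p := poisson (2 * c) x with hp
  have hN : Tendsto (fun n => ((2 * m n : ℕ) : ℝ) / n) atTop (nhds (2 * c)) := by
    refine (hm.const_mul 2).congr fun n => ?_
    push_cast; ring
  have h1 := tendsto_one_degree_prob hN x
  have h2 := tendsto_two_degree_prob hN x
  have hinv : Tendsto (fun n : ℕ => 1 / (n : ℝ)) atTop (nhds 0) :=
    tendsto_const_div_atTop_nhds_zero_nat 1
  have h := (((hinv.mul h1).add ((hinv.const_sub 1).mul h2)).sub (h1.const_mul (2 * p))).add_const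
    (p ^ 2)
  rw [← hp, show 0 * p + (1 - 0) * p ^ 2 - 2 * p * p + p ^ 2 = 0 by ring] at h
  refine h.congr' ?_
  filter_upwards [eventually_gt_atTop 0] with n hn
  have hn0 : (n : ℝ) ≠ 0 := by exact_mod_cast hn.ne'
  have hexp : ∀ G : Fin (m n) → Fin n × Fin n, (theta G x - p) ^ 2 =
      ((Finset.univ.filter fun v => deg G v = x).card : ℝ) ^ 2 * (1 / (n : ℝ) ^ 2) -
        ((Finset.univ.filter fun v => deg G v = x).card : ℝ) * (2 * p / n) + p ^ 2 := by
    intro G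
    rw [theta]; field_simp; ring
  simp only [hexp, Finset.sum_add_distrib, Finset.sum_sub_distrib, ← Finset.sum_mul,
    sum_card_deg_eq, sum_card_deg_eq_sq, Finset.sum_const, Finset.card_univ, nsmul_eq_mul]
  have hcard : ((Fintype.card (Fin (m n) → Fin n × Fin n) : ℕ) : ℝ) = (n : ℝ) ^ (2 * m n) := by
    simp [pow_mul, sq]
  rw [hcard]
  generalize (((2 * m n).choose x * (n - 1) ^ (2 * m n - x) : ℕ) : ℝ) = A
  generalize (((2 * m n).choose x * (2 * m n - x).choose x *
    (n - 2) ^ (2 * m n - x - x) : ℕ) : ℝ) = B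
  have hD : (n : ℝ) ^ (2 * m n) ≠ 0 := pow_ne_zero _ hn0
  generalize (n : ℝ) ^ (2 * m n) = D at hD
  field_simp

/-- Let `c > 0`, `λ = 2c`, `m_n / n → c`, and fix `ε > 0` and `x_max`. If the
expectation of `X_n(G) = R(G)·[∀ x ≤ x_max, |θ_x(G) − p(x,λ)| ≤ ε]` tends to `0`,
then the probability that a uniformly random `G` admits a proper 3-colouring tends
to `0`. -/
theorem stmt5 (c : ℝ) (hc : 0 < c) (m : ℕ → ℕ)
    (hm : Tendsto (fun n => (m n : ℝ) / n) atTop (nhds c))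
    (ε : ℝ) (hε : 0 < ε) (xmax : ℕ)
    (hX : Tendsto (fun n =>
      (∑ G : Fin (m n) → Fin n × Fin n,
        if ∀ x ≤ xmax, |theta G x - poisson (2 * c) x| ≤ ε then (R G : ℝ) else 0) /
        (n : ℝ) ^ (2 * m n)) atTop (nhds 0)) :
    Tendsto (fun n =>
      (Nat.card {G : Fin (m n) → Fin n × Fin n // ∃ σ : Fin n → Fin 3, Proper G σ} : ℝ) /
        (n : ℝ) ^ (2 * m n))
      atTop (nhds 0) := by
  have hbound : Tendsto (fun n =>
      (∑ G : Fin (m n) → Fin n × Fin n,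
        if ∀ x ≤ xmax, |theta G x - poisson (2 * c) x| ≤ ε then (R G : ℝ) else 0) /
        (n : ℝ) ^ (2 * m n) +
      (∑ x ∈ Finset.range (xmax + 1),
        (∑ G : Fin (m n) → Fin n × Fin n, (theta G x - poisson (2 * c) x) ^ 2) /
          (n : ℝ) ^ (2 * m n)) / ε ^ 2) atTop (nhds 0) := by
    simpa using hX.add ((tendsto_finsetSum (Finset.range (xmax + 1)) fun x _ =>
      tendsto_sum_theta_sub_poisson_sq hm x).div_const (ε ^ 2))
  refine squeeze_zero (fun n => by positivity) (fun n => ?_) hbound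
  rw [← Finset.sum_div, div_right_comm, ← add_div]
  refine div_le_div_of_nonneg_right ?_ (by positivity)
  rw [Nat.card_eq_fintype_card, Fintype.card_subtype, Finset.card_filter, Nat.cast_sum,
    Finset.sum_comm, Finset.sum_div, ← Finset.sum_add_distrib]
  refine Finset.sum_le_sum fun G _ => ?_
  have hnonneg : 0 ≤ (∑ x ∈ Finset.range (xmax + 1),
      (theta G x - poisson (2 * c) x) ^ 2) / ε ^ 2 := by positivity
  by_cases hcol : ∃ σ : Fin n → Fin 3, Proper G σ
  · rw [if_pos hcol, Nat.cast_one]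
    split_ifs with hG
    · have : (1 : ℝ) ≤ R G := by exact_mod_cast one_le_R_of_exists_proper G hcol
      linarith
    · push Not at hG
      obtain ⟨x, hx, hxε⟩ := hG
      rw [zero_add, one_le_div (by positivity)]
      calc ε ^ 2 ≤ |theta G x - poisson (2 * c) x| ^ 2 := by gcongr
        _ = (theta G x - poisson (2 * c) x) ^ 2 := sq_abs _
        _ ≤ _ := Finset.single_le_sum
          (f := fun x => (theta G x - poisson (2 * c) x) ^ 2) (fun _ _ => sq_nonneg _)
          (Finset.mem_range.mpr (Nat.lt_succ_of_le hx))
  · rw [if_neg hcol, Nat.cast_zero]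
    refine add_nonneg ?_ hnonneg
    split_ifs <;> positivity
end
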